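/- Let N ≥ 3, let τ_1 < τ_2 < … < τ_N be the N roots of the Lobatto polynomial L_N (so τ_1 = −1 and τ_N = 1), let τ_ξ ∈ [−1,1] be distinct from all of them, and let l_i denote the Lagrange basis polynomial of index i over the N+1 nodes τ_1, …, τ_N, τ_ξ. Let w_k = 2/(N(N−1)·P_{N−1}(τ_k)²) and D_{ki} = l_i'(τ_k). Define the N×N matrix D† by D†_{ki} = (δ_{ki}/w_k)·(δ_{kN} − δ_{k1}) − (w_i/w_k)·D_{ik} for k, i ∈ {1, …, N}, where δ denotes the Kronecker delta. Then D† is a differentiation matrix of order of accuracy N − 2 over τ_1, …, τ_N: for every real polynomial p of degree at most N − 2 and every k ∈ {1, …, N}, Σ_{i=1}^{N} D†_{ki}·p(τ_i) = p'(τ_k). -/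

import Mathlib

open Polynomial

/-- Legendre polynomial of degree `n`, via Rodrigues' formula (normalized so `P_n(1) = 1`). -/
noncomputable def legendreP (n : ℕ) : Polynomial ℝ :=
  Polynomial.C ((2 ^ n * n.factorial : ℝ)⁻¹) * (⇑Polynomial.derivative)^[n] ((X ^ 2 - 1) ^ n)

/-- Lobatto polynomial of degree `N`: `L_N(τ) = (τ² − 1)·P'_{N−1}(τ)`. -/
noncomputable def lobatto (N : ℕ) : Polynomial ℝ :=
  (X ^ 2 - 1) * Polynomial.derivative (legendreP (N - 1))

/-- Lagrange interpolating basis polynomial of index `i` over the nodes `τ`. -/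
noncomputable def lagrangeBasis {M : ℕ} (τ : Fin M → ℝ) (i : Fin M) : Polynomial ℝ :=
  ∏ j ∈ Finset.univ.erase i, (Polynomial.C (τ i - τ j)⁻¹ * (X - Polynomial.C (τ j)))

/-- Integration over `[-1, 1]` as a linear functional on polynomials. -/
noncomputable def polyIntegral : ℝ[X] →ₗ[ℝ] ℝ where
  toFun f := ∫ x in (-1 : ℝ)..1, f.eval x
  map_add' f g := by
    simp only [eval_add]
    exact intervalIntegral.integral_add (f.continuous.intervalIntegrable _ _)
      (g.continuous.intervalIntegrable _ _)
  map_smul' c f := by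
    simp

lemma polyIntegral_derivative (f : ℝ[X]) :
    polyIntegral (derivative f) = f.eval 1 - f.eval (-1) :=
  intervalIntegral.integral_eq_sub_of_hasDerivAt (fun x _ => f.hasDerivAt x)
    ((derivative f).continuous.intervalIntegrable _ _)

lemma polyIntegral_derivative_mul (f g : ℝ[X]) :
    polyIntegral (derivative f * g) =
      (f * g).eval 1 - (f * g).eval (-1) - polyIntegral (f * derivative g) := by
  rw [← polyIntegral_derivative, derivative_mul, map_add]
  ring

lemma polyIntegral_C_mul (c : ℝ) (f : ℝ[X]) : polyIntegral (C c * f) = c * polyIntegral f := by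
  rw [← smul_eq_C_mul, map_smul, smul_eq_mul]

lemma eval_iterate_derivative_X_sq_sub_one_pow {n k : ℕ} (hk : k < n) {x : ℝ} (hx : x ^ 2 = 1) :
    (derivative^[k] ((X ^ 2 - 1 : ℝ[X]) ^ n)).eval x = 0 := by
  obtain ⟨q, hq⟩ := pow_sub_dvd_iterate_derivative_pow (X ^ 2 - 1 : ℝ[X]) n k
  rw [hq, eval_mul, eval_pow]
  simp [hx, Nat.sub_ne_zero_of_lt hk]

lemma polyIntegral_iterate_derivative_mul_eq_zero {n k : ℕ} (hk : k ≤ n) {g : ℝ[X]}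
    (hg : g.degree < k) :
    polyIntegral (derivative^[k] ((X ^ 2 - 1) ^ n) * g) = 0 := by
  replace hg := iterate_derivative_eq_zero_of_degree_lt hg
  induction k generalizing g with
  | zero => simp_all
  | succ k ih =>
    rw [Function.iterate_succ_apply', polyIntegral_derivative_mul,
      ih (by omega) (by rwa [Function.iterate_succ_apply] at hg), eval_mul, eval_mul,
      eval_iterate_derivative_X_sq_sub_one_pow hk (by norm_num),
      eval_iterate_derivative_X_sq_sub_one_pow hk (by norm_num)]
    ring

lemma iterate_derivative_X_sq_sub_one_pow_recurrence (n m : ℕ) :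
    (X ^ 2 - 1) * derivative^[m + 2] ((X ^ 2 - 1 : ℝ[X]) ^ n)
      + C (2 * (m + 1) - 2 * n : ℝ) * X * derivative^[m + 1] ((X ^ 2 - 1) ^ n)
      + C ((m + 1) * m - 2 * n * (m + 1) : ℝ) * derivative^[m] ((X ^ 2 - 1) ^ n) = 0 := by
  induction m with
  | zero =>
    have h : (X ^ 2 - 1) * derivative ((X ^ 2 - 1 : ℝ[X]) ^ n)
        = C (2 * n : ℝ) * X * (X ^ 2 - 1) ^ n := by
      rcases n with _ | n
      · simp
      · simp only [derivative_pow, derivative_sub, derivative_X, derivative_one, Nat.add_sub_cancel,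
          map_mul, map_add, map_natCast, map_ofNat, map_one, Nat.cast_add, Nat.cast_one]
        push_cast
        ring
    have h2 := congrArg derivative h
    simp only [derivative_mul, derivative_sub, derivative_X_pow, derivative_one, derivative_C,
      derivative_X] at h2
    simp only [Function.iterate_succ_apply', Function.iterate_zero_apply]
    simp only [map_mul, map_natCast, map_ofNat, map_sub, map_add, map_one] at h2 ⊢
    push_cast at h2 ⊢
    linear_combination h2
  | succ m ih =>
    have h2 := congrArg derivative ih
    simp only [derivative_mul, derivative_sub, derivative_X_pow, derivative_one, derivative_C,
      derivative_X, derivative_add, derivative_zero, ← Function.iterate_succ_apply' derivative] at h2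
    simp only [map_mul, map_natCast, map_ofNat, map_sub, map_add, map_one] at h2 ⊢
    push_cast at h2 ⊢
    linear_combination h2

lemma X_sq_sub_one_mul_derivative_legendreP (m : ℕ) :
    (X ^ 2 - 1) * derivative (legendreP (m + 1)) =
      C (((m + 1) * (m + 2) : ℝ) * (2 ^ (m + 1) * (m + 1).factorial : ℝ)⁻¹) *
        derivative^[m] ((X ^ 2 - 1) ^ (m + 1)) := by
  have h := iterate_derivative_X_sq_sub_one_pow_recurrence (m + 1) m
  rw [legendreP, derivative_C_mul, ← Function.iterate_succ_apply' derivative]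
  generalize (2 ^ (m + 1) * (m + 1).factorial : ℝ)⁻¹ = c
  simp only [map_mul, map_natCast, map_ofNat, map_sub, map_add, map_one] at h ⊢
  push_cast at h ⊢
  linear_combination C c * h

lemma derivative_X_sq_sub_one_mul_derivative_legendreP (n : ℕ) :
    derivative ((X ^ 2 - 1) * derivative (legendreP n)) =
      C (n * (n + 1) : ℝ) * legendreP n := by
  rcases n with _ | m
  · simp [legendreP]
  · rw [X_sq_sub_one_mul_derivative_legendreP, derivative_C_mul,
      ← Function.iterate_succ_apply' derivative, legendreP, ← mul_assoc, ← C_mul]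
    congr 3
    push_cast
    ring

lemma polyIntegral_legendreP_mul {n : ℕ} {g : ℝ[X]} (hg : g.degree < n) :
    polyIntegral (legendreP n * g) = 0 := by
  rw [legendreP, mul_assoc, polyIntegral_C_mul,
    polyIntegral_iterate_derivative_mul_eq_zero le_rfl hg, mul_zero]

lemma polyIntegral_X_sq_sub_one_mul_derivative_legendreP_mul {n : ℕ} (hn : 1 ≤ n) {g : ℝ[X]}
    (hg : g.degree < (n - 1 : ℕ)) :
    polyIntegral ((X ^ 2 - 1) * derivative (legendreP n) * g) = 0 := by
  obtain ⟨m, rfl⟩ := Nat.exists_eq_add_of_le' hn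
  rw [X_sq_sub_one_mul_derivative_legendreP, mul_assoc, polyIntegral_C_mul,
    polyIntegral_iterate_derivative_mul_eq_zero (Nat.le_succ m) hg, mul_zero]

lemma eval_one_legendreP (n : ℕ) : (legendreP n).eval 1 = 1 := by
  have h := aeval_iterate_derivative_self (A := ℝ) ((X ^ 2 - 1 : ℝ[X]) ^ n) n 1
    (p' := (X + 1) ^ n) (by
      rw [Algebra.algebraMap_self, Polynomial.map_id, ← mul_pow, C_1]
      ring)
  rw [coe_aeval_eq_eval] at h
  rw [legendreP, eval_mul, eval_C, h]
  simp only [eval_pow, eval_add, eval_X, eval_one, nsmul_eq_mul]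
  have : (n.factorial : ℝ) ≠ 0 := by positivity
  field_simp
  norm_num

lemma natDegree_legendreP_le (n : ℕ) : (legendreP n).natDegree ≤ n := by
  refine (natDegree_C_mul_le _ _).trans ((natDegree_iterate_derivative _ _).trans ?_)
  have : ((X ^ 2 - 1 : ℝ[X]) ^ n).natDegree ≤ n * 2 :=
    natDegree_pow_le_of_le n (by compute_degree)
  omega

/-- Dividing a polynomial of degree at most `d + 1` by `X - C t` at a root `t` keeps
the leading coefficient. -/
lemma coeff_divByMonic_X_sub_C_of_natDegree_le {f : ℝ[X]} {d : ℕ} (hf : f.natDegree ≤ d + 1)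
    (t : ℝ) {m : ℕ} (hm : d ≤ m) : (f /ₘ (X - C t)).coeff m = f.coeff (m + 1) := by
  rw [coeff_divByMonic_X_sub_C_rec,
    coeff_eq_zero_of_natDegree_lt (p := f /ₘ (X - C t)) (n := m + 1), mul_zero, add_zero]
  rw [natDegree_divByMonic _ (monic_X_sub_C t), natDegree_X_sub_C]
  omega

lemma natDegree_X_sq_sub_one_mul_derivative_legendreP_le {n : ℕ} (hn : 1 ≤ n) :
    ((X ^ 2 - 1) * derivative (legendreP n)).natDegree ≤ n + 1 := by
  have h1 := natDegree_legendreP_le n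
  have h2 := natDegree_derivative_le (legendreP n)
  have h3 : (X ^ 2 - 1 : ℝ[X]).natDegree ≤ 2 := by compute_degree
  exact natDegree_mul_le.trans (by omega)

lemma coeff_X_sq_sub_one_mul_derivative_legendreP {n m : ℕ} (hm : n ≤ m) :
    ((X ^ 2 - 1) * derivative (legendreP n)).coeff (m + 1) = n * (legendreP n).coeff m := by
  have h0 : ∀ k, n < k → (legendreP n).coeff k = 0 := fun k hk =>
    coeff_eq_zero_of_natDegree_lt ((natDegree_legendreP_le n).trans_lt hk)
  have h1 := congrArg (fun f => coeff f m) (derivative_X_sq_sub_one_mul_derivative_legendreP n)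
  simp only [coeff_derivative, coeff_C_mul] at h1
  rcases hm.eq_or_lt with rfl | hm
  · have : (n + 1 : ℝ) ≠ 0 := by positivity
    apply mul_right_cancel₀ this
    rw [h1]; ring
  · rw [h0 m hm] at h1 ⊢
    have : (m + 1 : ℝ) ≠ 0 := by positivity
    simpa [this] using h1

lemma polyIntegral_divByMonic_mul_eval_legendreP_eq {n : ℕ} (hn : 1 ≤ n) {t : ℝ}
    (ht : ((X ^ 2 - 1) * derivative (legendreP n)).eval t = 0) :
    polyIntegral (((X ^ 2 - 1) * derivative (legendreP n)) /ₘ (X - C t)) * (legendreP n).eval t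
      = (2 * n + 1) * polyIntegral (legendreP n * legendreP n) := by
  have hP0 : ∀ k, n < k → (legendreP n).coeff k = 0 := fun k hk =>
    coeff_eq_zero_of_natDegree_lt ((natDegree_legendreP_le n).trans_lt hk)
  have hLd := natDegree_X_sq_sub_one_mul_derivative_legendreP_le hn
  have hLc := fun m => coeff_X_sq_sub_one_mul_derivative_legendreP (n := n) (m := m)
  have hI := fun g => polyIntegral_X_sq_sub_one_mul_derivative_legendreP_mul (g := g) hn
  have hL' := derivative_X_sq_sub_one_mul_derivative_legendreP n
  have hparts := polyIntegral_derivative_mul ((X ^ 2 - 1) * derivative (legendreP n)) (legendreP n)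
  have hM := mul_divByMonic_eq_iff_isRoot.mpr (show IsRoot _ t from ht)
  have hMP : polyIntegral (legendreP n *
      (((X ^ 2 - 1) * derivative (legendreP n)) /ₘ (X - C t) - C (n : ℝ) * legendreP n)) = 0 := by
    refine polyIntegral_legendreP_mul ((degree_lt_iff_coeff_zero _ _).mpr fun m hm => ?_)
    rw [coeff_sub, coeff_C_mul, coeff_divByMonic_X_sub_C_of_natDegree_le hLd t hm, hLc m hm,
      sub_self]
  have hroot : IsRoot (legendreP n - C ((legendreP n).eval t)) t := by simp
  have hh := mul_divByMonic_eq_iff_isRoot.mpr hroot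
  have hLh : polyIntegral ((X ^ 2 - 1) * derivative (legendreP n) *
      (C (n : ℝ) * ((legendreP n - C ((legendreP n).eval t)) /ₘ (X - C t))
        - derivative (legendreP n))) = 0 := by
    refine hI _ ((degree_lt_iff_coeff_zero _ _).mpr fun m hm => ?_)
    have hd : (legendreP n - C ((legendreP n).eval t)).natDegree ≤ (n - 1) + 1 := by
      rw [natDegree_sub_C]
      have := natDegree_legendreP_le n
      omega
    rw [coeff_sub, coeff_C_mul, coeff_divByMonic_X_sub_C_of_natDegree_le hd t hm, coeff_derivative,
      coeff_sub, coeff_C_succ, sub_zero]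
    rcases eq_or_ne (m + 1) n with h | h
    · rw [← h]; push_cast; ring
    · rw [hP0 _ (by omega)]; ring
  generalize ((X ^ 2 - 1) * derivative (legendreP n)) /ₘ (X - C t) = M at *
  generalize (legendreP n - C ((legendreP n).eval t)) /ₘ (X - C t) = h at *
  rw [hL', mul_assoc, polyIntegral_C_mul] at hparts
  rw [mul_sub, map_sub, mul_left_comm, polyIntegral_C_mul] at hMP hLh
  have hn0 : (n : ℝ) ≠ 0 := by positivity
  have hsplit : polyIntegral M * (legendreP n).eval t =
      polyIntegral (legendreP n * M) -
        polyIntegral ((X ^ 2 - 1) * derivative (legendreP n) * h) := by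
    rw [mul_comm, ← polyIntegral_C_mul, ← map_sub]
    congr 1
    linear_combination (-h) * hM + M * hh
  simp only [eval_mul, eval_sub, eval_pow, eval_X, eval_one] at hparts
  apply mul_left_cancel₀ hn0
  rw [hsplit]
  linear_combination n * hMP - hLh - hparts

lemma polyIntegral_divByMonic_mul_eval_legendreP {n : ℕ} (hn : 1 ≤ n) {t : ℝ}
    (ht : ((X ^ 2 - 1) * derivative (legendreP n)).eval t = 0) :
    polyIntegral (((X ^ 2 - 1) * derivative (legendreP n)) /ₘ (X - C t)) * (legendreP n).eval t
      = 2 := by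
  rw [polyIntegral_divByMonic_mul_eval_legendreP_eq hn ht,
    ← polyIntegral_divByMonic_mul_eval_legendreP_eq hn (t := 1) (by simp), eval_one_legendreP]
  have h : (X ^ 2 - 1) * derivative (legendreP n) =
      (X - C 1) * (derivative (legendreP n) * (X + 1)) := by
    rw [C_1]; ring
  have h0 : polyIntegral (legendreP n * 1) = 0 :=
    polyIntegral_legendreP_mul (by rw [degree_one]; exact_mod_cast hn)
  rw [h, mul_divByMonic_cancel_left _ (monic_X_sub_C 1), polyIntegral_derivative_mul]
  simp only [derivative_add, derivative_X, derivative_one, add_zero, h0, eval_mul,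
    eval_one_legendreP, eval_add, eval_X, eval_one]
  ring

/-- The Gauss–Lobatto quadrature rule. -/
lemma polyIntegral_eq_sum_lobatto {n : ℕ} (hn : 1 ≤ n) {τ : Fin (n + 1) → ℝ}
    (hτ : Function.Injective τ) (hroots : ∀ k, (lobatto (n + 1)).eval (τ k) = 0)
    {f : ℝ[X]} (hf : f.natDegree < 2 * n) :
    polyIntegral f = ∑ k, 2 / (n * (n + 1) * (legendreP n).eval (τ k) ^ 2) * f.eval (τ k) := by
  have hLd := natDegree_X_sq_sub_one_mul_derivative_legendreP_le hn
  have hI := fun g => polyIntegral_X_sq_sub_one_mul_derivative_legendreP_mul (g := g) hn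
  have hW := fun k => polyIntegral_divByMonic_mul_eval_legendreP hn (hroots k)
  have hL' := derivative_X_sq_sub_one_mul_derivative_legendreP n
  simp only [lobatto, Nat.add_sub_cancel] at hroots
  generalize (X ^ 2 - 1) * derivative (legendreP n) = L at *
  have hn0 : (n : ℝ) ≠ 0 := by positivity
  have hn1 : (n + 1 : ℝ) ≠ 0 := by positivity
  have hL0 : L ≠ 0 := by
    rintro rfl
    have := congrArg (eval 1) hL'
    simp [eval_one_legendreP, hn0, hn1] at this
  have hLdeg : L.natDegree = n + 1 := by
    refine le_antisymm hLd (not_lt.mp fun hlt => hL0 ?_)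
    exact eq_zero_of_natDegree_lt_card_of_eval_eq_zero L hτ hroots (by simpa using hlt)
  have hP : ∀ k, (legendreP n).eval (τ k) ≠ 0 := fun k h => by
    have := hW k
    simp [h] at this
  have hM : ∀ k, (X - C (τ k)) * (L /ₘ (X - C (τ k))) = L := fun k =>
    mul_divByMonic_eq_iff_isRoot.mpr (hroots k)
  have hMself : ∀ k, (L /ₘ (X - C (τ k))).eval (τ k) = n * (n + 1) * (legendreP n).eval (τ k) := by
    intro k
    have h1 := congrArg (eval (τ k)) hL'
    rw [← hM k, derivative_mul] at h1
    simpa using h1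
  have hMne : ∀ k j, j ≠ k → (L /ₘ (X - C (τ k))).eval (τ j) = 0 := by
    intro k j hjk
    have h1 := congrArg (eval (τ j)) (hM k)
    rw [hroots j, eval_mul] at h1
    simpa [sub_ne_zero.mpr (hτ.ne hjk)] using h1
  have hinterp : f % L =
      ∑ k, C (f.eval (τ k) / (n * (n + 1) * (legendreP n).eval (τ k))) * (L /ₘ (X - C (τ k))) := by
    refine Polynomial.eq_of_degrees_lt_of_eval_index_eq Finset.univ hτ.injOn ?_ ?_ ?_
    · refine (EuclideanDomain.mod_lt f hL0).trans_le ?_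
      rw [degree_eq_natDegree hL0, hLdeg]; simp
    · refine (degree_lt_iff_coeff_zero _ _).mpr fun m hm => ?_
      rw [finsetSum_coeff]
      refine Finset.sum_eq_zero fun k _ => ?_
      rw [coeff_C_mul, coeff_eq_zero_of_natDegree_lt, mul_zero]
      rw [natDegree_divByMonic _ (monic_X_sub_C _), natDegree_X_sub_C, hLdeg]
      simp at hm
      omega
    · intro j _
      have h1 := congrArg (eval (τ j)) (EuclideanDomain.div_add_mod f L)
      rw [eval_add, eval_mul, hroots j, zero_mul, zero_add] at h1
      rw [h1, eval_finsetSum, Finset.sum_eq_single j]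
      · rw [eval_mul, eval_C, hMself]
        field_simp [hP j]
      · intro k _ hk
        rw [eval_mul, hMne k j hk.symm, mul_zero]
      · simp
  have hq : polyIntegral (L * (f / L)) = 0 := by
    by_cases h0 : f / L = 0
    · simp [h0]
    refine hI _ ((natDegree_lt_iff_degree_lt h0).mp ?_)
    have h1 : L.degree ≤ f.degree := not_lt.mp fun h => h0 ((Polynomial.div_eq_zero_iff hL0).mpr h)
    have h2 := degree_add_div hL0 h1
    rw [degree_eq_natDegree hL0, degree_eq_natDegree h0, degree_eq_natDegree (p := f)
      (by rintro rfl; simp at h0), hLdeg] at h2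
    norm_cast at h2
    omega
  conv_lhs => rw [← EuclideanDomain.div_add_mod f L, map_add, hq, zero_add, hinterp, map_sum]
  refine Finset.sum_congr rfl fun k _ => ?_
  rw [polyIntegral_C_mul]
  have := hP k
  rw [show polyIntegral (L /ₘ (X - C (τ k))) = 2 / (legendreP n).eval (τ k) from
    eq_div_of_mul_eq this (hW k)]
  field_simp

/-- the dual matrix
`D†_{ki} = (δ_{ki}/w_k)(δ_{kN} − δ_{k1}) − (w_i/w_k)·D_{ik}` built from the
differentiation matrix `D` over the roots of `L_N` together with the exceptional node
`τ_ξ` is a differentiation matrix of order of accuracy `N − 2` over the roots of `L_N`. -/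
theorem dual_matrix_is_diffMatrix {N : ℕ} (hN : 3 ≤ N)
    (τ : Fin N → ℝ) (hmono : StrictMono τ)
    (hroots : ∀ k, (lobatto N).eval (τ k) = 0)
    (hfirst : τ ⟨0, by omega⟩ = -1) (hlast : τ ⟨N - 1, by omega⟩ = 1)
    (τξ : ℝ) (hξ : τξ ∈ Set.Icc (-1 : ℝ) 1) (hne : ∀ k, τξ ≠ τ k)
    (w : Fin N → ℝ)
    (hw : ∀ k, w k = 2 / ((N : ℝ) * ((N : ℝ) - 1) * (legendreP (N - 1)).eval (τ k) ^ 2))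
    (D : Matrix (Fin N) (Fin (N + 1)) ℝ)
    (hD : ∀ k i, D k i = (Polynomial.derivative (lagrangeBasis (Fin.snoc τ τξ) i)).eval (τ k))
    (Ddag : Matrix (Fin N) (Fin N) ℝ)
    (hDdag : ∀ k i : Fin N, Ddag k i =
      (if k = i then (1 : ℝ) else 0) / w k
          * ((if (k : ℕ) = N - 1 then (1 : ℝ) else 0) - (if (k : ℕ) = 0 then (1 : ℝ) else 0))
        - w i / w k * D i k.castSucc) :
    ∀ p : Polynomial ℝ, p.natDegree ≤ N - 2 → ∀ k : Fin N,
      ∑ i, Ddag k i * p.eval (τ i) = (Polynomial.derivative p).eval (τ k) := by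
  obtain ⟨n, rfl⟩ : ∃ n, N = n + 1 := ⟨N - 1, by omega⟩
  intro p hp k
  have hn : 1 ≤ n := by omega
  have hτ := hmono.injective
  have hw' : ∀ k, w k = 2 / (n * (n + 1) * (legendreP n).eval (τ k) ^ 2) := fun k => by
    rw [hw k, Nat.add_sub_cancel]
    push_cast
    ring_nf
  have hwk : w k ≠ 0 := by
    have hP : (legendreP n).eval (τ k) ≠ 0 := fun h => by
      have := polyIntegral_divByMonic_mul_eval_legendreP hn (hroots k)
      simp [h] at this
    rw [hw' k]
    positivity
  have hquad : ∀ f : ℝ[X], f.natDegree < 2 * n → polyIntegral f = ∑ i, w i * f.eval (τ i) :=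
    fun f hf => by
      simp_rw [hw']
      exact polyIntegral_eq_sum_lobatto hn hτ hroots hf
  have hv : Function.Injective (Fin.snoc τ τξ : Fin (n + 1 + 1) → ℝ) :=
    Fin.snoc_injective_iff.mpr ⟨hτ, fun ⟨i, hi⟩ => hne i hi.symm⟩
  set l := lagrangeBasis (Fin.snoc τ τξ) k.castSucc with hl
  have hlagrange : l = Lagrange.basis Finset.univ (Fin.snoc τ τξ) k.castSucc := rfl
  have hdeg : l.natDegree = n + 1 := by
    rw [hlagrange, Lagrange.natDegree_basis hv.injOn (Finset.mem_univ _)]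
    simp
  have heval : ∀ i, l.eval (τ i) = if k = i then 1 else 0 := by
    intro i
    have hi : τ i = (Fin.snoc τ τξ : Fin (n + 1 + 1) → ℝ) i.castSucc := by simp
    rw [hlagrange, hi]
    split_ifs with h
    · rw [h, Lagrange.eval_basis_self hv.injOn (Finset.mem_univ _)]
    · exact Lagrange.eval_basis_of_ne (by simpa using h) (Finset.mem_univ _)
  have hparts := polyIntegral_derivative_mul l p
  have hdl := natDegree_derivative_le l
  have hdp := natDegree_derivative_le p
  rw [hquad _ (natDegree_mul_le.trans_lt (by omega)),
    hquad _ (natDegree_mul_le.trans_lt (by omega))] at hparts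
  have hsum : ∑ i, w i * (l * derivative p).eval (τ i) = w k * (derivative p).eval (τ k) := by
    simp [heval]
  have hend1 : (l * p).eval 1 = (if (k : ℕ) = n then 1 else 0) * p.eval (τ k) := by
    have h1 : (l * p).eval 1 = (l * p).eval (τ ⟨n + 1 - 1, by omega⟩) := by rw [hlast]
    rw [h1, eval_mul, heval]
    by_cases h : (k : ℕ) = n
    · have hk : k = ⟨n + 1 - 1, by omega⟩ := Fin.ext h
      rw [← hk, if_pos rfl, if_pos h]
    · have hk : k ≠ ⟨n + 1 - 1, by omega⟩ := fun hk => h (congrArg Fin.val hk)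
      simp only [if_neg hk, if_neg h, zero_mul]
  have hend0 : (l * p).eval (-1) = (if (k : ℕ) = 0 then 1 else 0) * p.eval (τ k) := by
    rw [← hfirst, eval_mul, heval]
    by_cases h : (k : ℕ) = 0
    · have hk : k = ⟨0, by omega⟩ := Fin.ext h
      rw [← hk, if_pos rfl, if_pos h]
    · have hk : k ≠ ⟨0, by omega⟩ := fun hk => h (congrArg Fin.val hk)
      simp only [if_neg hk, if_neg h, zero_mul]
  rw [hsum, hend1, hend0] at hparts
  have hlhs : ∑ i, Ddag k i * p.eval (τ i) =
      ((if (k : ℕ) = n then (1 : ℝ) else 0) - (if (k : ℕ) = 0 then (1 : ℝ) else 0)) * p.eval (τ k)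
        / w k - (∑ i, w i * (derivative l * p).eval (τ i)) / w k := by
    simp_rw [hDdag, hD, ← hl, sub_mul, Finset.sum_sub_distrib, Finset.sum_div, Nat.add_sub_cancel]
    congr 1
    · rw [Finset.sum_eq_single k]
      · rw [if_pos rfl]; ring
      · intro i _ hi
        rw [if_neg hi.symm]; ring
      · simp
    · refine Finset.sum_congr rfl fun i _ => ?_
      rw [eval_mul]; ring
  rw [hlhs, hparts]
  field_simp
  ring
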